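/- Non-negativity of the discrete-in-time iterates for the 1-2 junction scheme: if f^{1,n}, f^{2,n}, f^{3,n} ∈ B and the time step satisfies Δt < 1/(1 + η_0), then the explicit Euler updates f^{1,n+1}, f^{2,n+1}, f^{3,n+1} of the 1-2 junction scheme satisfy f^{r,n+1}_j ≥ 0 for all j = 1,...,n and r = 1,2,3. -/

import Mathlib

open Set

noncomputable def rhoF {n : ℕ} (f : Fin n → ℝ) : ℝ := ∑ j, f j

noncomputable def fluxF {n : ℕ} (v f : Fin n → ℝ) : ℝ := ∑ j, v j * f j

noncomputable def gainF {n : ℕ} (η0 : ℝ) (A : Fin n → Fin n → Fin n → ℝ → ℝ)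
    (j : Fin n) (f : Fin n → ℝ) : ℝ :=
  η0 * rhoF f * ∑ h, ∑ k, A h k j (rhoF f) * f h * f k

noncomputable def lossF {n : ℕ} (η0 : ℝ) (f : Fin n → ℝ) : ℝ := η0 * (rhoF f) ^ 2

def admissibleF {n : ℕ} (f : Fin n → ℝ) : Prop :=
  (∀ j, 0 ≤ f j ∧ f j ≤ 1) ∧ rhoF f ≤ 1

noncomputable def deltaC {n : ℕ} (j : Fin n) : ℝ := if (j : ℕ) = 0 then 0 else 1

def IsSpeedLattice {n : ℕ} (hn : 2 ≤ n) (v : Fin n → ℝ) : Prop :=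
  StrictMono v ∧ v ⟨0, by omega⟩ = 0 ∧ v ⟨n - 1, by omega⟩ = 1

def IsFluxLimiterW (Φ : ℝ → ℝ → ℝ) : Prop :=
  (∀ u ∈ Icc (0:ℝ) 1, ∀ w ∈ Icc (0:ℝ) 1, Φ u w ∈ Icc (0:ℝ) 1) ∧
  (∀ u ∈ Icc (0:ℝ) 1, ∀ w ∈ Icc (0:ℝ) 1, 1 < u + w → Φ u w * u ≤ 1 - w)

def IsTableOfGamesW {n : ℕ} (A : Fin n → Fin n → Fin n → ℝ → ℝ) : Prop :=
  (∀ h k j : Fin n, ∀ u ∈ Icc (0:ℝ) 1, A h k j u ∈ Icc (0:ℝ) 1) ∧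
  (∀ h k : Fin n, ∀ u ∈ Icc (0:ℝ) 1, ∑ j, A h k j u = 1)

noncomputable def euler1 {n : ℕ} (v : Fin n → ℝ) (η0 : ℝ) (A : Fin n → Fin n → Fin n → ℝ → ℝ)
    (Φ : ℝ → ℝ → ℝ) (a Δt : ℝ) (fbar1 f1 f2 f3 : Fin n → ℝ) (j : Fin n) : ℝ :=
  f1 j - Δt * v j * ((a * Φ (a * ∑ k, deltaC k * f1 k) (rhoF f2)
      + (1 - a) * Φ ((1 - a) * ∑ k, deltaC k * f1 k) (rhoF f3)) * f1 j
    - Φ (∑ k, fbar1 k) (rhoF f1) * fbar1 j)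
  + Δt * (gainF η0 A j f1 - f1 j * lossF η0 f1)

noncomputable def euler2 {n : ℕ} (v : Fin n → ℝ) (η0 : ℝ) (A : Fin n → Fin n → Fin n → ℝ → ℝ)
    (Φ : ℝ → ℝ → ℝ) (a Δt : ℝ) (Φbar2 : ℝ) (f1 f2 : Fin n → ℝ) (j : Fin n) : ℝ :=
  f2 j - Δt * v j * (Φbar2 * f2 j
    - a * Φ (a * ∑ k, deltaC k * f1 k) (rhoF f2) * f1 j * deltaC j)
  + Δt * (gainF η0 A j f2 - f2 j * lossF η0 f2)

noncomputable def euler3 {n : ℕ} (v : Fin n → ℝ) (η0 : ℝ) (A : Fin n → Fin n → Fin n → ℝ → ℝ)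
    (Φ : ℝ → ℝ → ℝ) (a Δt : ℝ) (Φbar3 : ℝ) (f1 f3 : Fin n → ℝ) (j : Fin n) : ℝ :=
  f3 j - Δt * v j * (Φbar3 * f3 j
    - (1 - a) * Φ ((1 - a) * ∑ k, deltaC k * f1 k) (rhoF f3) * f1 j * deltaC j)
  + Δt * (gainF η0 A j f3 - f3 j * lossF η0 f3)

theorem deltaC_nonneg {n : ℕ} (j : Fin n) : 0 ≤ deltaC j := by
  unfold deltaC; split_ifs <;> norm_num

theorem deltaC_le_one {n : ℕ} (j : Fin n) : deltaC j ≤ 1 := by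
  unfold deltaC; split_ifs <;> norm_num

theorem rhoF_mem_Icc {n : ℕ} {f : Fin n → ℝ} (hf : admissibleF f) : rhoF f ∈ Icc (0 : ℝ) 1 :=
  ⟨Finset.sum_nonneg fun j _ => (hf.1 j).1, hf.2⟩

theorem sum_deltaC_mul_mem_Icc {n : ℕ} {f : Fin n → ℝ} (hf : admissibleF f) :
    ∑ k, deltaC k * f k ∈ Icc (0 : ℝ) 1 :=
  ⟨Finset.sum_nonneg fun k _ => mul_nonneg (deltaC_nonneg k) (hf.1 k).1,
    (Finset.sum_le_sum fun k _ => mul_le_of_le_one_left (hf.1 k).1 (deltaC_le_one k)).trans hf.2⟩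

theorem mul_mem_Icc_zero_one {x y : ℝ} (hx : x ∈ Icc (0 : ℝ) 1) (hy : y ∈ Icc (0 : ℝ) 1) :
    x * y ∈ Icc (0 : ℝ) 1 :=
  ⟨mul_nonneg hx.1 hy.1, mul_le_one₀ hx.2 hy.1 hy.2⟩

theorem gainF_nonneg {n : ℕ} {η0 : ℝ} (hη0 : 0 ≤ η0) {A : Fin n → Fin n → Fin n → ℝ → ℝ}
    (hA : IsTableOfGamesW A) {f : Fin n → ℝ} (hf : admissibleF f) (j : Fin n) :
    0 ≤ gainF η0 A j f :=
  mul_nonneg (mul_nonneg hη0 (rhoF_mem_Icc hf).1) <|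
    Finset.sum_nonneg fun h _ => Finset.sum_nonneg fun k _ =>
      mul_nonneg (mul_nonneg (hA.1 h k j _ (rhoF_mem_Icc hf)).1 (hf.1 h).1) (hf.1 k).1

theorem lossF_le {n : ℕ} {η0 : ℝ} (hη0 : 0 ≤ η0) {f : Fin n → ℝ} (hf : admissibleF f) :
    lossF η0 f ≤ η0 :=
  mul_le_of_le_one_right hη0 (pow_le_one₀ (rhoF_mem_Icc hf).1 hf.2)

theorem IsSpeedLattice.mem_Icc {n : ℕ} {hn : 2 ≤ n} {v : Fin n → ℝ} (hv : IsSpeedLattice hn v)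
    (j : Fin n) : v j ∈ Icc (0 : ℝ) 1 := by
  refine ⟨?_, ?_⟩
  · rw [← hv.2.1]
    exact hv.1.monotone (Fin.le_def.2 (Nat.zero_le _))
  · rw [← hv.2.2]
    exact hv.1.monotone (Fin.le_def.2 (Nat.le_sub_one_of_lt j.isLt))

/-- An explicit Euler step with outflow rate `w * c ≤ 1`, loss rate `L ≤ η` and nonnegative
sources keeps a nonnegative density nonnegative as long as `t < 1 / (1 + η)`. -/
theorem euler_step_nonneg {x t w c s G L η : ℝ} (hη : 0 ≤ η) (hx : 0 ≤ x) (ht : 0 ≤ t)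
    (htη : t < 1 / (1 + η)) (hw : w ∈ Icc (0 : ℝ) 1) (hc : c ∈ Icc (0 : ℝ) 1) (hs : 0 ≤ s)
    (hG : 0 ≤ G) (hL : L ≤ η) :
    0 ≤ x - t * w * (c * x - s) + t * (G - x * L) := by
  have hrate : t * (w * c + L) ≤ 1 := by
    have h1 : t * (1 + η) < 1 := (lt_div_iff₀ (by linarith)).1 htη
    have h2 : t * (w * c + L) ≤ t * (1 + η) :=
      mul_le_mul_of_nonneg_left (add_le_add (mul_mem_Icc_zero_one hw hc).2 hL) ht
    linarith
  have hsource : 0 ≤ t * w * s := mul_nonneg (mul_nonneg ht hw.1) hs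
  have hgain : 0 ≤ t * G := mul_nonneg ht hG
  have hrest : 0 ≤ x * (1 - t * (w * c + L)) := mul_nonneg hx (by linarith)
  linarith

/-- Non-negativity of the discrete-in-time iterates for the 1-2 junction scheme. -/
theorem euler_scheme_nonneg
    {n : ℕ} (hn : 2 ≤ n) (v : Fin n → ℝ) (hv : IsSpeedLattice hn v)
    (η0 : ℝ) (hη0 : 0 < η0)
    (A : Fin n → Fin n → Fin n → ℝ → ℝ) (hA : IsTableOfGamesW A)
    (Φ : ℝ → ℝ → ℝ) (hΦ : IsFluxLimiterW Φ)
    (a : ℝ) (ha : a ∈ Icc (0:ℝ) 1)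
    (f1 f2 f3 fbar1 : Fin n → ℝ)
    (hf1 : admissibleF f1) (hf2 : admissibleF f2) (hf3 : admissibleF f3)
    (hfbar1 : admissibleF fbar1)
    (Φbar2 Φbar3 : ℝ) (hΦbar2 : Φbar2 ∈ Icc (0:ℝ) 1) (hΦbar3 : Φbar3 ∈ Icc (0:ℝ) 1)
    (Δt : ℝ) (hΔt0 : 0 < Δt)
    (hΔt : Δt < 1 / (1 + η0)) :
    ∀ j : Fin n,
      0 ≤ euler1 v η0 A Φ a Δt fbar1 f1 f2 f3 j ∧
      0 ≤ euler2 v η0 A Φ a Δt Φbar2 f1 f2 j ∧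
      0 ≤ euler3 v η0 A Φ a Δt Φbar3 f1 f3 j := by
  intro j
  have ha' : 1 - a ∈ Icc (0 : ℝ) 1 := ⟨by linarith [ha.2], by linarith [ha.1]⟩
  have hΦ2 := hΦ.1 _ (mul_mem_Icc_zero_one ha (sum_deltaC_mul_mem_Icc hf1)) _ (rhoF_mem_Icc hf2)
  have hΦ3 := hΦ.1 _ (mul_mem_Icc_zero_one ha' (sum_deltaC_mul_mem_Icc hf1)) _ (rhoF_mem_Icc hf3)
  have hΦ1 := hΦ.1 _ (rhoF_mem_Icc hfbar1) _ (rhoF_mem_Icc hf1)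
  have hout := convex_Icc (0 : ℝ) 1 hΦ2 hΦ3 ha.1 ha'.1 (by ring)
  refine ⟨?_, ?_, ?_⟩
  · exact euler_step_nonneg hη0.le (hf1.1 j).1 hΔt0.le hΔt (hv.mem_Icc j) hout
      (mul_nonneg hΦ1.1 (hfbar1.1 j).1) (gainF_nonneg hη0.le hA hf1 j) (lossF_le hη0.le hf1)
  · exact euler_step_nonneg hη0.le (hf2.1 j).1 hΔt0.le hΔt (hv.mem_Icc j) hΦbar2
      (mul_nonneg (mul_nonneg (mul_nonneg ha.1 hΦ2.1) (hf1.1 j).1) (deltaC_nonneg j))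
      (gainF_nonneg hη0.le hA hf2 j) (lossF_le hη0.le hf2)
  · exact euler_step_nonneg hη0.le (hf3.1 j).1 hΔt0.le hΔt (hv.mem_Icc j) hΦbar3
      (mul_nonneg (mul_nonneg (mul_nonneg ha'.1 hΦ3.1) (hf1.1 j).1) (deltaC_nonneg j))
      (gainF_nonneg hη0.le hA hf3 j) (lossF_le hη0.le hf3)
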